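/- Suppose M₁₁ ≥ 0 and −M₂₂ ≥ 0, let k ∈ H, and suppose v* ∈ H satisfies Mv* + k = 0. Then for every ε > 0, the element u_ε := −M_ε⁻¹k (which is well defined since M_ε is invertible) satisfies ‖u_ε‖ ≤ ‖v*‖. -/

import Mathlib

open scoped RealInnerProductSpace

/-- The block operator `(u₁, u₂) ↦ (M₁₁u₁ + M₁₂u₂, M₂₁u₁ + M₂₂u₂)` on the product
Hilbert space `H₁ ×₂ H₂` (with the `L²` product norm). -/
noncomputable def blockOp {H₁ H₂ : Type*}
    [NormedAddCommGroup H₁] [InnerProductSpace ℝ H₁]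
    [NormedAddCommGroup H₂] [InnerProductSpace ℝ H₂]
    (M11 : H₁ →L[ℝ] H₁) (M12 : H₂ →L[ℝ] H₁)
    (M21 : H₁ →L[ℝ] H₂) (M22 : H₂ →L[ℝ] H₂) :
    WithLp 2 (H₁ × H₂) →L[ℝ] WithLp 2 (H₁ × H₂) :=
  ((WithLp.prodContinuousLinearEquiv 2 ℝ H₁ H₂).symm.toContinuousLinearMap) ∘L
    ((M11 ∘L ContinuousLinearMap.fst ℝ H₁ H₂ + M12 ∘L ContinuousLinearMap.snd ℝ H₁ H₂).prod
      (M21 ∘L ContinuousLinearMap.fst ℝ H₁ H₂ + M22 ∘L ContinuousLinearMap.snd ℝ H₁ H₂)) ∘L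
    ((WithLp.prodContinuousLinearEquiv 2 ℝ H₁ H₂).toContinuousLinearMap)

/-- The element of the product Hilbert space `H₁ ×₂ H₂` with components `a` and `b`. -/
noncomputable def pairL2 {H₁ H₂ : Type*}
    [NormedAddCommGroup H₁] [InnerProductSpace ℝ H₁]
    [NormedAddCommGroup H₂] [InnerProductSpace ℝ H₂]
    (a : H₁) (b : H₂) : WithLp 2 (H₁ × H₂) :=
  (WithLp.equiv 2 (H₁ × H₂)).symm (a, b)

/-- Lax-Milgram for operators: a bounded operator with `c‖u‖² ≤ ⟪A u, u⟫`, `c > 0`, is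
a continuous linear equivalence. -/
theorem exists_continuousLinearEquiv_of_coercive {V : Type*} [NormedAddCommGroup V]
    [InnerProductSpace ℝ V] [CompleteSpace V] (A : V →L[ℝ] V) {c : ℝ} (hc : 0 < c)
    (hA : ∀ u, c * ‖u‖ * ‖u‖ ≤ ⟪A u, u⟫) :
    ∃ e : V ≃L[ℝ] V, ∀ u, e u = A u := by
  have hB : IsCoercive ((innerSL ℝ : V →L[ℝ] V →L[ℝ] ℝ) ∘L A) := ⟨c, hc, hA⟩
  refine ⟨hB.continuousLinearEquivOfBilin, fun u => ?_⟩
  refine ext_inner_right ℝ fun w => ?_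
  rw [hB.continuousLinearEquivOfBilin_apply]
  rfl

theorem withLp_prod_ext {α β : Type*} {u w : WithLp 2 (α × β)} (h₁ : u.fst = w.fst)
    (h₂ : u.snd = w.snd) : u = w :=
  WithLp.ofLp_injective 2 (Prod.ext h₁ h₂)

section BlockOp

variable {H₁ H₂ : Type*} [NormedAddCommGroup H₁] [InnerProductSpace ℝ H₁]
  [NormedAddCommGroup H₂] [InnerProductSpace ℝ H₂]

@[simp]
theorem blockOp_apply_fst (M11 : H₁ →L[ℝ] H₁) (M12 : H₂ →L[ℝ] H₁) (M21 : H₁ →L[ℝ] H₂)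
    (M22 : H₂ →L[ℝ] H₂) (u : WithLp 2 (H₁ × H₂)) :
    (blockOp M11 M12 M21 M22 u).fst = M11 u.fst + M12 u.snd := rfl

@[simp]
theorem blockOp_apply_snd (M11 : H₁ →L[ℝ] H₁) (M12 : H₂ →L[ℝ] H₁) (M21 : H₁ →L[ℝ] H₂)
    (M22 : H₂ →L[ℝ] H₂) (u : WithLp 2 (H₁ × H₂)) :
    (blockOp M11 M12 M21 M22 u).snd = M21 u.fst + M22 u.snd := rfl

/-- The signature operator `(u₁, u₂) ↦ (u₁, -u₂)`. -/
noncomputable def signatureOp (H₁ H₂ : Type*) [NormedAddCommGroup H₁] [InnerProductSpace ℝ H₁]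
    [NormedAddCommGroup H₂] [InnerProductSpace ℝ H₂] :
    WithLp 2 (H₁ × H₂) →L[ℝ] WithLp 2 (H₁ × H₂) :=
  blockOp (ContinuousLinearMap.id ℝ H₁) 0 0 (-ContinuousLinearMap.id ℝ H₂)

@[simp]
theorem signatureOp_signatureOp (u : WithLp 2 (H₁ × H₂)) :
    signatureOp H₁ H₂ (signatureOp H₁ H₂ u) = u :=
  withLp_prod_ext (by simp [signatureOp]) (by simp [signatureOp])

theorem blockOp_perturbed_apply (M11 : H₁ →L[ℝ] H₁) (M12 : H₂ →L[ℝ] H₁) (M21 : H₁ →L[ℝ] H₂)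
    (M22 : H₂ →L[ℝ] H₂) (ε : ℝ) (u : WithLp 2 (H₁ × H₂)) :
    blockOp (M11 + ε • ContinuousLinearMap.id ℝ H₁) M12 M21
        (M22 - ε • ContinuousLinearMap.id ℝ H₂) u =
      blockOp M11 M12 M21 M22 u + ε • signatureOp H₁ H₂ u :=
  withLp_prod_ext (by simp [signatureOp]; abel) (by simp [signatureOp]; abel)

theorem inner_signatureOp_blockOp_nonneg [CompleteSpace H₁] [CompleteSpace H₂]
    {M11 : H₁ →L[ℝ] H₁} (M12 : H₂ →L[ℝ] H₁) {M22 : H₂ →L[ℝ] H₂}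
    (h11 : ∀ u₁ : H₁, 0 ≤ ⟪M11 u₁, u₁⟫) (h22 : ∀ u₂ : H₂, 0 ≤ ⟪(-M22) u₂, u₂⟫)
    (u : WithLp 2 (H₁ × H₂)) :
    0 ≤ ⟪signatureOp H₁ H₂ (blockOp M11 M12 (ContinuousLinearMap.adjoint M12) M22 u), u⟫ := by
  have h₁ := h11 u.fst
  have h₂ := h22 u.snd
  have h₃ : ⟪ContinuousLinearMap.adjoint M12 u.fst, u.snd⟫ = ⟪M12 u.snd, u.fst⟫ := by
    rw [ContinuousLinearMap.adjoint_inner_left, real_inner_comm]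
  simp only [WithLp.prod_inner_apply, WithLp.ofLp_fst, WithLp.ofLp_snd, signatureOp,
    blockOp_apply_fst, blockOp_apply_snd, ContinuousLinearMap.id_apply,
    zero_apply, neg_apply, add_zero, zero_add,
    inner_add_left, inner_neg_left] at h₂ ⊢
  linarith

end BlockOp

/-- If `M₁₁ ≥ 0`, `−M₂₂ ≥ 0`, and `v*` solves `Mv* + k = 0`, then for every `ε > 0` the
element `u_ε = −M_ε⁻¹k` (well defined since `M_ε` is invertible) satisfies `‖u_ε‖ ≤ ‖v*‖`. -/
theorem perturbed_saddle_norm_le {H₁ H₂ : Type*}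
    [NormedAddCommGroup H₁] [InnerProductSpace ℝ H₁] [CompleteSpace H₁]
    [NormedAddCommGroup H₂] [InnerProductSpace ℝ H₂] [CompleteSpace H₂]
    (M11 : H₁ →L[ℝ] H₁) (M12 : H₂ →L[ℝ] H₁)
    (M21 : H₁ →L[ℝ] H₂) (M22 : H₂ →L[ℝ] H₂)
    (h21 : M21 = ContinuousLinearMap.adjoint M12)
    (h11sa : IsSelfAdjoint M11) (h22sa : IsSelfAdjoint M22)
    (h11pos : ∀ u₁ : H₁, 0 ≤ ⟪M11 u₁, u₁⟫)
    (h22neg : ∀ u₂ : H₂, 0 ≤ ⟪(-M22) u₂, u₂⟫)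
    (k vs : WithLp 2 (H₁ × H₂))
    (hvs : blockOp M11 M12 M21 M22 vs + k = 0)
    (ε : ℝ) (hε : 0 < ε) :
    (∃ S : WithLp 2 (H₁ × H₂) →L[ℝ] WithLp 2 (H₁ × H₂),
      S ∘L blockOp (M11 + ε • ContinuousLinearMap.id ℝ H₁) M12 M21
          (M22 - ε • ContinuousLinearMap.id ℝ H₂) = ContinuousLinearMap.id ℝ _ ∧
      blockOp (M11 + ε • ContinuousLinearMap.id ℝ H₁) M12 M21
          (M22 - ε • ContinuousLinearMap.id ℝ H₂) ∘L S = ContinuousLinearMap.id ℝ _) ∧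
    ∀ S : WithLp 2 (H₁ × H₂) →L[ℝ] WithLp 2 (H₁ × H₂),
      S ∘L blockOp (M11 + ε • ContinuousLinearMap.id ℝ H₁) M12 M21
          (M22 - ε • ContinuousLinearMap.id ℝ H₂) = ContinuousLinearMap.id ℝ _ →
      blockOp (M11 + ε • ContinuousLinearMap.id ℝ H₁) M12 M21
          (M22 - ε • ContinuousLinearMap.id ℝ H₂) ∘L S = ContinuousLinearMap.id ℝ _ →
      ‖-(S k)‖ ≤ ‖vs‖ := by
  subst h21
  have hJ := inner_signatureOp_blockOp_nonneg M12 h11pos h22neg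
  have hM := blockOp_perturbed_apply M11 M12 (ContinuousLinearMap.adjoint M12) M22 ε
  set M := blockOp M11 M12 (ContinuousLinearMap.adjoint M12) M22
  set Mε := blockOp (M11 + ε • ContinuousLinearMap.id ℝ H₁) M12 (ContinuousLinearMap.adjoint M12)
    (M22 - ε • ContinuousLinearMap.id ℝ H₂)
  set J := signatureOp H₁ H₂
  have hJJ : ∀ u, J (J u) = u := signatureOp_signatureOp
  refine ⟨?_, fun S _ hS => ?_⟩
  · obtain ⟨e, he⟩ := exists_continuousLinearEquiv_of_coercive (J ∘L Mε) hε fun u => by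
      rw [ContinuousLinearMap.comp_apply, hM, map_add, map_smul, hJJ, inner_add_left,
        real_inner_smul_left, real_inner_self_eq_norm_mul_norm, mul_assoc]
      linarith [hJ u]
    refine ⟨(e.symm : _ →L[ℝ] _) ∘L J, ?_, ?_⟩ <;> ext1 u
    · exact (congrArg e.symm (he u)).symm.trans (e.symm_apply_apply u)
    · change Mε (e.symm (J u)) = u
      have h : J (Mε (e.symm (J u))) = J u := (he _).symm.trans (e.apply_symm_apply _)
      rw [← hJJ (Mε _), h, hJJ]
  · have hMS : Mε (S k) = k := DFunLike.congr_fun hS k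
    set u := -(S k) with hu
    have hdiff : M (vs - u) = ε • J u := by
      have h : M u + ε • J u = -k := by rw [← hM, hu, map_neg, hMS]
      rw [map_sub, eq_neg_of_add_eq_zero_left hvs, ← h, add_sub_cancel_left]
    have hinner : 0 ≤ ε * ⟪u, vs - u⟫ := by
      simpa only [hdiff, map_smul, hJJ, real_inner_smul_left] using hJ (vs - u)
    have h := nonneg_of_mul_nonneg_right hinner hε
    rw [inner_sub_right, real_inner_self_eq_norm_mul_norm] at h
    by_contra! hlt
    nlinarith [real_inner_le_norm u vs, norm_nonneg vs]
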